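/- Let f ∈ C²(ℝ^d) with unique minimizer at 0, f(0)=0, PL constant C_PL, and ∇²f(0) ≻ 0. Let Σ_t = t·[∇²f(0)]⁻¹ and Z_t = ∫ e^{-f/t}. Then log(Z_t / √det(2πΣ_t)) → 0 as t → 0⁺. -/

import Mathlib

open Real MeasureTheory Filter Topology
open scoped RealInnerProductSpace

lemma quad_growth {d : ℕ}
    (f : EuclideanSpace ℝ (Fin d) → ℝ) (C : ℝ) (hC : 0 < C)
    (hf : Differentiable ℝ f) (hpos : ∀ y, y ≠ 0 → 0 < f y) (hf0 : f 0 = 0)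
    (hPL : ∀ x, f x ≤ C / 2 * ‖gradient f x‖ ^ 2) (x : EuclideanSpace ℝ (Fin d)) :
    1 / (4 * C) * ‖x‖ ^ 2 ≤ f x := by
  have hnn : ∀ y, 0 ≤ f y := by
    intro y
    by_cases h : y = 0
    · rw [h, hf0]
    · exact (hpos y h).le
  obtain ⟨k, hk, hkC⟩ : ∃ k : ℝ, 0 < k ∧ k ^ 2 = 1 / (4 * C) :=
    ⟨√(1 / (4 * C)), by positivity, Real.sq_sqrt (by positivity)⟩
  have hcont : Continuous (fun y => √(f y) + k * dist y x) := by
    have := hf.continuous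
    fun_prop
  have hlim : Tendsto (fun y => √(f y) + k * dist y x) (cocompact _) atTop := by
    refine tendsto_atTop_mono (fun y => ?_)
      ((tendsto_dist_right_cocompact_atTop x).const_mul_atTop hk)
    have := Real.sqrt_nonneg (f y)
    linarith
  obtain ⟨y, hy⟩ := hcont.exists_forall_le hlim
  have hy' : ∀ z, √(f y) ≤ √(f z) + k * dist z y := by
    intro z
    have h1 := hy z
    have h2 := dist_triangle z y x
    nlinarith
  have hy0 : y = 0 := by
    by_contra hne
    have hfy := hpos y hne
    set w := gradient f y with hw
    have hline : HasDerivAt (fun s : ℝ => y + s • (-w)) (-w) 0 := by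
      simpa using ((hasDerivAt_id (0:ℝ)).smul_const (-w)).const_add y
    have hg := (hf y).hasGradientAt.hasFDerivAt
    have hfl : HasDerivAt (fun s : ℝ => f (y + s • (-w))) (-‖w‖ ^ 2) 0 := by
      have := HasFDerivAt.comp_hasDerivAt_of_eq (0:ℝ) hg hline (by simp)
      simpa [← hw, Function.comp_def] using this
    have hs : HasDerivAt (fun s : ℝ => √(f (y + s • (-w)))) (-‖w‖ ^ 2 / (2 * √(f y))) 0 := by
      have := hfl.sqrt (by simpa using hfy.ne')
      simpa using this
    have hlim := hs.tendsto_slope_zero_right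
    have hge : -(k * ‖w‖) ≤ -‖w‖ ^ 2 / (2 * √(f y)) := by
      refine ge_of_tendsto hlim ?_
      filter_upwards [self_mem_nhdsWithin] with s hs
      have hs : 0 < s := hs
      have h1 := hy' (y + s • (-w))
      have h2 : dist (y + s • (-w)) y = s * ‖w‖ := by
        simp [dist_eq_norm, norm_smul, abs_of_pos hs]
      rw [h2] at h1
      simp only [zero_add, zero_smul, add_zero, smul_eq_mul]
      rw [inv_mul_eq_div, le_div_iff₀ hs]
      linarith
    have hq : 0 < √(f y) := Real.sqrt_pos.2 hfy
    have hqq : √(f y) ^ 2 = f y := Real.sq_sqrt hfy.le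
    rw [le_div_iff₀ (by positivity)] at hge
    have hP := hPL y
    rw [← hw] at hP
    have hwpos : 0 < ‖w‖ := by
      rcases (norm_nonneg w).lt_or_eq with h | h
      · exact h
      · rw [← h] at hP; norm_num at hP; linarith
    have h3 : ‖w‖ ≤ 2 * k * √(f y) := by
      refine le_of_mul_le_mul_left (a := ‖w‖) ?_ hwpos
      nlinarith
    have h4 : ‖w‖ ^ 2 ≤ 4 * k ^ 2 * f y := by
      calc ‖w‖ ^ 2 ≤ (2 * k * √(f y)) ^ 2 := by gcongr
        _ = _ := by rw [mul_pow, mul_pow, hqq]; ring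
    rw [hkC] at h4
    have h5 : C * ‖w‖ ^ 2 ≤ f y := by
      calc C * ‖w‖ ^ 2 ≤ C * (4 * (1 / (4 * C)) * f y) := by gcongr
        _ = f y := by field_simp
    linarith
  have h := hy x
  rw [hy0, hf0] at h
  simp at h
  rw [← hkC, ← mul_pow, ← Real.sq_sqrt (hnn x)]
  gcongr

lemma taylor_two {d : ℕ}
    (f : EuclideanSpace ℝ (Fin d) → ℝ) (hf : ContDiff ℝ 2 f) (hf0 : f 0 = 0)
    (hmin : ∀ y, f 0 ≤ f y) (y : EuclideanSpace ℝ (Fin d)) :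
    Tendsto (fun s : ℝ => f (s • y) / s ^ 2) (𝓝[>] 0)
      (𝓝 (⟪y, fderiv ℝ (gradient f) 0 y⟫ / 2)) := by
  have hd : Differentiable ℝ f := hf.differentiable (by norm_num)
  have hG : Differentiable ℝ (gradient f) := by
    have h1 : Differentiable ℝ (fderiv ℝ f) :=
      (hf.fderiv_right (m := 1) (by norm_num)).differentiable (by norm_num)
    exact ((InnerProductSpace.toDual ℝ _).symm.toContinuousLinearEquiv.differentiable).comp h1
  have hline : ∀ s : ℝ, HasDerivAt (fun s : ℝ => s • y) y s := by
    intro s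
    simpa using (hasDerivAt_id s).smul_const y
  have hg0 : gradient f 0 = 0 := by
    have : IsLocalMin f 0 := Filter.Eventually.of_forall hmin
    simp [gradient, this.fderiv_eq_zero]
  refine HasDerivAt.lhopital_zero_nhdsGT (f' := fun s => ⟪y, gradient f (s • y)⟫)
    (g' := fun s => 2 * s) ?_ ?_ ?_ ?_ ?_ ?_
  · refine Eventually.of_forall fun s => ?_
    have := HasFDerivAt.comp_hasDerivAt s (hd (s • y)).hasGradientAt.hasFDerivAt (hline s)
    simpa [Function.comp_def, real_inner_comm] using this
  · refine Eventually.of_forall fun s => ?_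
    simpa using hasDerivAt_pow 2 s
  · filter_upwards [self_mem_nhdsWithin] with s hs
    have hs : 0 < s := hs
    positivity
  · have : Continuous (fun s : ℝ => f (s • y)) := by
      have := hd.continuous
      fun_prop
    have := this.tendsto 0
    simp only [zero_smul, hf0] at this
    exact this.mono_left nhdsWithin_le_nhds
  · have : Continuous (fun s : ℝ => s ^ 2) := by fun_prop
    have := this.tendsto 0
    simp only [ne_eq, OfNat.ofNat_ne_zero, not_false_eq_true, zero_pow] at this
    exact this.mono_left nhdsWithin_le_nhds
  · have h1 : HasDerivAt (fun s : ℝ => gradient f (s • y)) (fderiv ℝ (gradient f) 0 y) 0 :=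
      HasFDerivAt.comp_hasDerivAt_of_eq (0:ℝ) (hG 0).hasFDerivAt (hline 0) (by simp)
    have h2 : HasDerivAt (fun s : ℝ => ⟪y, gradient f (s • y)⟫)
        ⟪y, fderiv ℝ (gradient f) 0 y⟫ 0 := by
      simpa using (hasDerivAt_const (0:ℝ) y).inner ℝ h1
    have h3 := h2.tendsto_slope_zero_right.div_const 2
    refine h3.congr fun s => ?_
    simp [hg0]
    ring

lemma gauss {d : ℕ} (H : Matrix (Fin d) (Fin d) ℝ) (hH : H.PosDef) :
    ∫ y : EuclideanSpace ℝ (Fin d), rexp (-(⟪y, Matrix.toEuclideanLin H y⟫ / 2))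
      = √((2 * π) ^ d / H.det) := by
  obtain ⟨B, hB⟩ : ∃ B : Matrix (Fin d) (Fin d) ℝ, H = B.conjTranspose * B := by
    open scoped MatrixOrder in
    exact CStarAlgebra.nonneg_iff_eq_star_mul_self.mp hH.posSemidef.nonneg
  have hdet : H.det = B.det ^ 2 := by
    rw [hB, Matrix.det_mul, Matrix.det_conjTranspose]; simp [sq]
  have hdB : B.det ≠ 0 := by
    intro h
    have := hH.det_pos
    rw [hdet, h] at this
    simp at this
  set L := Matrix.toEuclideanLin B with hL
  have hLdet : LinearMap.det L = B.det := by
    simp [hL, LinearMap.det_toLpLin]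
  have hnorm : ∀ y, ⟪y, Matrix.toEuclideanLin H y⟫ = ‖L y‖ ^ 2 := by
    intro y
    rw [← real_inner_self_eq_norm_sq, hB, Matrix.toLpLin_mul_same, LinearMap.comp_apply,
      Matrix.toEuclideanLin_conjTranspose_eq_adjoint, LinearMap.adjoint_inner_right]
  have hmap := Measure.map_linearMap_addHaar_eq_smul_addHaar
    (volume : Measure (EuclideanSpace ℝ (Fin d))) (f := L) (by rwa [hLdet])
  have hLc : Continuous L := L.continuous_of_finiteDimensional
  have h1 : ∫ y, rexp (-(1/2) * ‖L y‖ ^ 2)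
      = ∫ z, rexp (-(1/2) * ‖z‖ ^ 2) ∂(Measure.map L volume) := by
    rw [integral_map hLc.aemeasurable]
    exact Continuous.aestronglyMeasurable (by fun_prop)
  have h2 : ∀ y, rexp (-(⟪y, Matrix.toEuclideanLin H y⟫ / 2)) = rexp (-(1/2) * ‖L y‖ ^ 2) := by
    intro y
    rw [hnorm]; ring_nf
  simp_rw [h2]
  rw [h1, hmap, integral_smul_measure, GaussianFourier.integral_rexp_neg_mul_sq_norm (by norm_num),
    hLdet, hdet, Real.sqrt_div' _ (by positivity), Real.sqrt_sq_eq_abs,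
    ENNReal.toReal_ofReal (by positivity), finrank_euclideanSpace_fin, abs_inv, smul_eq_mul,
    inv_mul_eq_div]
  congr 1
  rw [Real.sqrt_eq_rpow, ← Real.rpow_natCast, ← Real.rpow_mul (by positivity)]
  congr 1 <;> ring

theorem normalizing_constant_asymptotics {d : ℕ}
    (f : EuclideanSpace ℝ (Fin d) → ℝ) (CPL : ℝ) (hCPL : 0 < CPL)
    (hf : ContDiff ℝ 2 f) (hf0 : f 0 = 0)
    (hmin : ∀ y, f 0 ≤ f y) (huniq : ∀ y, (∀ z, f y ≤ f z) → y = 0)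
    (hPL : ∀ x, f x ≤ CPL / 2 * ‖gradient f x‖ ^ 2)
    (H : Matrix (Fin d) (Fin d) ℝ)
    (hH : H = fun i j => ⟪EuclideanSpace.single i (1 : ℝ),
      fderiv ℝ (gradient f) 0 (EuclideanSpace.single j (1 : ℝ))⟫)
    (hHpos : H.PosDef)
    (hint : ∀ t : ℝ, 0 < t → Integrable (fun x => Real.exp (-f x / t))) :
    Tendsto (fun t : ℝ =>
        Real.log ((∫ x, Real.exp (-f x / t)) / Real.sqrt ((2 * Real.pi * t) ^ d / H.det)))
      (𝓝[>] 0) (𝓝 0) := by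
  have hd : Differentiable ℝ f := hf.differentiable (by norm_num)
  have hpos : ∀ y, y ≠ 0 → 0 < f y := by
    intro y hy
    by_contra h
    exact hy (huniq y fun z => by linarith [hmin z])
  have hgrow := quad_growth f CPL hCPL hd hpos hf0 hPL
  have hHL : ∀ y, fderiv ℝ (gradient f) 0 y = Matrix.toEuclideanLin H y := by
    intro y
    have : (fderiv ℝ (gradient f) 0 : _ →ₗ[ℝ] _) = Matrix.toEuclideanLin H := by
      refine (EuclideanSpace.basisFun (Fin d) ℝ).toBasis.ext fun j => ?_
      ext i
      have hij : H i j = (fderiv ℝ (gradient f) 0 (EuclideanSpace.single j (1 : ℝ))) i := by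
        simp [hH, EuclideanSpace.inner_single_left]
      have hr : (Matrix.toEuclideanLin H (EuclideanSpace.single j (1 : ℝ))) i = H i j := by
        simp [Matrix.toEuclideanLin, Matrix.toLpLin_apply]
      simp only [OrthonormalBasis.coe_toBasis, EuclideanSpace.basisFun_apply,
        ContinuousLinearMap.coe_coe]
      rw [hr, hij]
    exact congrArg (fun l => l y) this
  have hdet := hHpos.det_pos
  set G := √((2 * π) ^ d / H.det) with hG
  have hGpos : 0 < G := Real.sqrt_pos.2 (by positivity)
  have hgauss := gauss H hHpos
  -- dominated convergence for the rescaled integral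
  have hDC : Tendsto (fun s : ℝ => ∫ y, rexp (-(f (s • y) / s ^ 2))) (𝓝[>] 0) (𝓝 G) := by
    rw [hG, ← hgauss]
    refine tendsto_integral_filter_of_dominated_convergence
      (fun y => rexp (-(1 / (4 * CPL)) * ‖y‖ ^ 2)) ?_ ?_ ?_ ?_
    · refine Eventually.of_forall fun s => Continuous.aestronglyMeasurable ?_
      have := hd.continuous
      fun_prop
    · filter_upwards [self_mem_nhdsWithin] with s hs
      have hs : 0 < s := hs
      refine Eventually.of_forall fun y => ?_
      rw [Real.norm_eq_abs, Real.abs_exp, Real.exp_le_exp, neg_mul, neg_le_neg_iff,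
        le_div_iff₀ (by positivity)]
      have := hgrow (s • y)
      rw [norm_smul, mul_pow, Real.norm_eq_abs, sq_abs] at this
      linarith
    · refine Integrable.of_integral_ne_zero ?_
      rw [GaussianFourier.integral_rexp_neg_mul_sq_norm (by positivity)]
      positivity
    · refine Eventually.of_forall fun y => ?_
      have h := (taylor_two f hf hf0 hmin y).neg
      rw [hHL] at h
      exact (Real.continuous_exp.tendsto _).comp h
  have hsqrt : Tendsto (fun t : ℝ => √t) (𝓝[>] 0) (𝓝[>] 0) := by
    refine tendsto_nhdsWithin_iff.2 ⟨?_, ?_⟩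
    · have := Real.continuous_sqrt.tendsto 0
      rw [Real.sqrt_zero] at this
      exact this.mono_left nhdsWithin_le_nhds
    · filter_upwards [self_mem_nhdsWithin] with t ht
      exact Real.sqrt_pos.2 ht
  have h1 := ((hDC.comp hsqrt).div_const G).log (by simp [hGpos.ne'])
  rw [div_self hGpos.ne', Real.log_one] at h1
  refine h1.congr' ?_
  filter_upwards [self_mem_nhdsWithin] with t ht
  have ht : 0 < t := ht
  have hst : 0 < √t := Real.sqrt_pos.2 ht
  have hcv := Measure.integral_comp_smul (volume : Measure (EuclideanSpace ℝ (Fin d)))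
    (fun x => rexp (-f x / t)) (√t)
  have he : √((2 * π * t) ^ d / H.det) = √t ^ d * G := by
    rw [hG, ← Real.sqrt_sq (by positivity : 0 ≤ √t ^ d), ← Real.sqrt_mul (by positivity),
      ← pow_mul, mul_comm d 2, pow_mul, Real.sq_sqrt ht.le, mul_pow]
    congr 1
    ring
  rw [finrank_euclideanSpace_fin, smul_eq_mul, abs_of_pos (by positivity)] at hcv
  simp only [Function.comp_apply, Real.sq_sqrt ht.le, ← neg_div]
  rw [hcv, he]
  congr 1
  field_simp
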